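/- arXiv:2304.12451 — 2 statements merged into one kernel-verified Lean document; each statement's English description precedes it below -/
import Mathlib

section
/- Let F be an m×k complex matrix with rank(F) = k and let Y* be a k×m complex matrix. If the m×m matrix F Y* is idempotent ((F Y*)² = F Y*) and rank(F Y*) = k, then Y* F = I_k, the k×k identity matrix. -/
open Matrix

/-- Converse direction (Langenhop): if `F` has full column rank `k` and `F * Y` is
idempotent of rank `k`, then the projector equation `Y * F = 1` holds. -/
theorem projector_equation_of_idempotent_rank
    (m k : ℕ)
    (F : Matrix (Fin m) (Fin k) ℂ) (Y : Matrix (Fin k) (Fin m) ℂ)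
    (hrankF : F.rank = k)
    (hidem : (F * Y) * (F * Y) = F * Y)
    (hrank : (F * Y).rank = k) :
    Y * F = 1 := by
  have h1 : k ≤ (Y * F).rank := by
    have e : F * Y = F * ((Y * F) * Y) := by
      simp only [Matrix.mul_assoc] at hidem ⊢; exact hidem.symm
    calc k = (F * ((Y * F) * Y)).rank := by rw [← e, hrank]
      _ ≤ ((Y * F) * Y).rank := Matrix.rank_mul_le_right _ _
      _ ≤ (Y * F).rank := Matrix.rank_mul_le_left _ _
  have h2 : Function.Surjective (Y * F).mulVecLin := by
    rw [← LinearMap.range_eq_top]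
    apply Submodule.eq_top_of_finrank_eq
    have h3 : (Y * F).rank ≤ k := Matrix.rank_le_width _
    have h4 : (Y * F).rank = k := le_antisymm h3 h1
    rw [Module.finrank_fin_fun]
    exact h4
  have hu : IsUnit (Y * F) := Matrix.mulVec_surjective_iff_isUnit.mp h2
  have h5 : (Y * F) * ((Y * F) * (Y * F)) = (Y * F) * ((Y * F) * 1) := by
    have h6 := congrArg (fun M => Y * M * F) hidem
    simpa only [Matrix.mul_assoc, Matrix.mul_one] using h6
  exact hu.mul_left_cancel (hu.mul_left_cancel h5)
end

section
/- (Main theorem.) Let A be an m×n complex matrix of rank k, and let F be an m×r complex matrix and H an n×q complex matrix, with k ≤ r, k ≤ q, rank(F) = rank(H) = k, such that the column space of A is contained in the column space of F (there exists C with A = F C) and the column space of A* is contained in the column space of H (there exists C' with A* = H C'). Let B be an m×r complex matrix and D an n×q complex matrix satisfying the rank-preserving condition rank(B* F) = rank(H* D) = k. Let M₁ satisfy the four Penrose equations with respect to B* F and M₂ the four Penrose equations with respect to H* D, and set Y* := M₁ B* and X := D M₂. Then for every r×q matrix W, A = F G H*, where G = Y* A X + W − Y* F W H* X. -/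
open Matrix

open scoped ComplexOrder in
lemma rank_conjTranspose_aux {m r : ℕ} (F : Matrix (Fin m) (Fin r) ℂ) :
    Fᴴ.rank = F.rank := Matrix.rank_conjTranspose F

lemma hidden_projector_aux {m r s : ℕ} (F : Matrix (Fin m) (Fin r) ℂ)
    (P : Matrix (Fin s) (Fin m) ℂ) (M : Matrix (Fin r) (Fin s) ℂ)
    (hr : (P * F).rank = F.rank) (h : (P * F) * M * (P * F) = P * F) :
    F * M * P * F = F := by
  have hle : LinearMap.ker F.mulVecLin ≤ LinearMap.ker (P * F).mulVecLin := by
    intro v hv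
    simp only [LinearMap.mem_ker, Matrix.mulVecLin_apply] at hv ⊢
    rw [← Matrix.mulVec_mulVec, hv, Matrix.mulVec_zero]
  have h1 := LinearMap.finrank_range_add_finrank_ker F.mulVecLin
  have h2 := LinearMap.finrank_range_add_finrank_ker (P * F).mulVecLin
  unfold Matrix.rank at hr
  have heq := Submodule.eq_of_le_of_finrank_eq hle (by omega)
  apply Matrix.ext_of_mulVec_single
  intro i
  generalize (Pi.single i 1 : Fin r → ℂ) = v
  have hv : M *ᵥ ((P * F) *ᵥ v) - v ∈ LinearMap.ker F.mulVecLin := by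
    rw [heq]
    simp only [LinearMap.mem_ker, Matrix.mulVecLin_apply, Matrix.mulVec_sub]
    rw [Matrix.mulVec_mulVec, Matrix.mulVec_mulVec, h, sub_self]
  simp only [LinearMap.mem_ker, Matrix.mulVecLin_apply, Matrix.mulVec_sub] at hv
  rw [← sub_eq_zero, ← hv]
  simp only [Matrix.mulVec_mulVec, Matrix.mul_assoc]

/-- Main theorem: reconstruction of a rank-`k` matrix `A` from hidden projectors built
from rank-preserving matrices `B`, `D` and pseudoinverses of `Bᴴ * F` and `Hᴴ * D`. -/
theorem matrix_factorization_main
    (m n r q k : ℕ)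
    (A : Matrix (Fin m) (Fin n) ℂ)
    (F : Matrix (Fin m) (Fin r) ℂ)
    (H : Matrix (Fin n) (Fin q) ℂ)
    (B : Matrix (Fin m) (Fin r) ℂ)
    (D : Matrix (Fin n) (Fin q) ℂ)
    (M₁ : Matrix (Fin r) (Fin r) ℂ)
    (M₂ : Matrix (Fin q) (Fin q) ℂ)
    (hkr : k ≤ r) (hkq : k ≤ q)
    (hrankA : A.rank = k) (hrankF : F.rank = k) (hrankH : H.rank = k)
    (hColA : ∃ C : Matrix (Fin r) (Fin n) ℂ, A = F * C)
    (hColA' : ∃ C' : Matrix (Fin q) (Fin m) ℂ, Aᴴ = H * C')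
    (hrankBF : (Bᴴ * F).rank = k) (hrankHD : (Hᴴ * D).rank = k)
    (hM₁1 : (Bᴴ * F) * M₁ * (Bᴴ * F) = Bᴴ * F)
    (hM₁2 : M₁ * (Bᴴ * F) * M₁ = M₁)
    (hM₁3 : ((Bᴴ * F) * M₁)ᴴ = (Bᴴ * F) * M₁)
    (hM₁4 : (M₁ * (Bᴴ * F))ᴴ = M₁ * (Bᴴ * F))
    (hM₂1 : (Hᴴ * D) * M₂ * (Hᴴ * D) = Hᴴ * D)
    (hM₂2 : M₂ * (Hᴴ * D) * M₂ = M₂)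
    (hM₂3 : ((Hᴴ * D) * M₂)ᴴ = (Hᴴ * D) * M₂)
    (hM₂4 : (M₂ * (Hᴴ * D))ᴴ = M₂ * (Hᴴ * D)) :
    ∀ W : Matrix (Fin r) (Fin q) ℂ,
      A = F * ((M₁ * Bᴴ) * A * (D * M₂) + W
              - (M₁ * Bᴴ) * F * W * Hᴴ * (D * M₂)) * Hᴴ := by
  intro W
  have e1 : F * M₁ * Bᴴ * F = F :=
    hidden_projector_aux F Bᴴ M₁ (hrankBF.trans hrankF.symm) hM₁1
  have e2' : H * M₂ᴴ * Dᴴ * H = H := by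
    apply hidden_projector_aux H Dᴴ M₂ᴴ
    · rw [hrankH, ← hrankHD, ← rank_conjTranspose_aux (Hᴴ * D)]
      simp
    · have := congrArg Matrix.conjTranspose hM₂1
      simpa [Matrix.conjTranspose_mul, Matrix.mul_assoc] using this
  have e2 : Hᴴ * D * M₂ * Hᴴ = Hᴴ := by
    have := congrArg Matrix.conjTranspose e2'
    simpa [Matrix.conjTranspose_mul, Matrix.mul_assoc] using this
  obtain ⟨C, hC⟩ := hColA
  obtain ⟨C', hC'⟩ := hColA'
  have hA : A = C'ᴴ * Hᴴ := by
    have := congrArg Matrix.conjTranspose hC'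
    simpa [Matrix.conjTranspose_mul] using this
  have a1 : F * M₁ * Bᴴ * A = A := by
    rw [hC, ← Matrix.mul_assoc, e1]
  have a2 : A * D * M₂ * Hᴴ = A := by
    rw [hA]
    calc C'ᴴ * Hᴴ * D * M₂ * Hᴴ = C'ᴴ * (Hᴴ * D * M₂ * Hᴴ) := by
          simp only [Matrix.mul_assoc]
      _ = _ := by rw [e2]
  have t1 : F * ((M₁ * Bᴴ) * A * (D * M₂)) * Hᴴ = A := by
    calc _ = (F * M₁ * Bᴴ * A) * D * M₂ * Hᴴ := by simp only [Matrix.mul_assoc]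
      _ = A := by rw [a1, a2]
  have t2 : F * ((M₁ * Bᴴ) * F * W * Hᴴ * (D * M₂)) * Hᴴ = F * W * Hᴴ := by
    calc _ = (F * M₁ * Bᴴ * F) * W * (Hᴴ * D * M₂ * Hᴴ) := by
          simp only [Matrix.mul_assoc]
      _ = _ := by rw [e1, e2]
  rw [Matrix.mul_sub, Matrix.mul_add, Matrix.sub_mul, Matrix.add_mul, t1, t2]
  simp
end
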